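/- Let Q ⊂ P^2 be a reduced quartic curve with a singular point q of type A_k (local equation t^2 + s^{k+1} = 0 in suitable local analytic coordinates), and let ℓ be a line through q not contained in Q. Then the local intersection multiplicity (Q·ℓ)_q satisfies: if (Q·ℓ)_q = 3 then k ≤ 2; and for any such configuration (Q·ℓ)_q ∈ {2, 3, 4} with the pairs (k, (Q·ℓ)_q) restricted to: (k,2) for 1 ≤ k ≤ 7, (k,3) for 1 ≤ k ≤ 2, and (k,4) for 1 ≤ k ≤ 7 with k ≠ 2. -/

import Mathlib

/-- `IsAk F k` says the plane curve germ at the origin defined by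
`F ∈ ℂ[s,t]` is an `A_k` singularity: in suitable local (formal analytic) coordinates,
i.e. after a `ℂ`-algebra automorphism of the power series ring `ℂ[[s,t]]`, its ideal
becomes the ideal generated by `t² + s^{k+1}`. -/
def IsAk (F : MvPolynomial (Fin 2) ℂ) (k : ℕ) : Prop :=
  ∃ φ : MvPowerSeries (Fin 2) ℂ ≃ₐ[ℂ] MvPowerSeries (Fin 2) ℂ,
    Ideal.map (φ : MvPowerSeries (Fin 2) ℂ →+* MvPowerSeries (Fin 2) ℂ)
      (Ideal.span {(F : MvPowerSeries (Fin 2) ℂ)}) =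
    Ideal.span {(MvPowerSeries.X 0) ^ 2 + (MvPowerSeries.X 1) ^ (k + 1)}

/-- `projAk T p k` says the projective plane curve defined by the homogeneous
`T ∈ ℂ[z₀,z₁,z₂]` has an `A_k` singularity at the projective point `[p]`: after a linear
change of coordinates moving `(0:0:1)` to `[p]`, the dehomogenization of `T` in the chart
`z₂ = 1` has an `A_k` singularity at the origin. -/
def projAk (T : MvPolynomial (Fin 3) ℂ) (p : Fin 3 → ℂ) (k : ℕ) : Prop :=
  ∃ M : Matrix (Fin 3) (Fin 3) ℂ, IsUnit M.det ∧ M.mulVec ![0, 0, 1] = p ∧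
    IsAk ((MvPolynomial.aeval ![MvPolynomial.X 0, MvPolynomial.X 1, 1])
      ((MvPolynomial.aeval fun i => ∑ j, MvPolynomial.C (M i j) * MvPolynomial.X j) T)) k

lemma exTheta : ∃ Θ : MvPowerSeries (Fin 2) ℂ →ₐ[ℂ] PowerSeries (MvPolynomial (Fin 2) ℂ),
    (∀ i, Θ (MvPowerSeries.X i) = PowerSeries.C (MvPolynomial.X i) * PowerSeries.X) ∧
    (∀ P d, (PowerSeries.coeff d (Θ P)).IsHomogeneous d) := by
  have ha : MvPowerSeries.HasSubst (fun i : Fin 2 =>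
    (PowerSeries.C (MvPolynomial.X i : MvPolynomial (Fin 2) ℂ) * PowerSeries.X :
      PowerSeries (MvPolynomial (Fin 2) ℂ))) := by
    apply MvPowerSeries.hasSubst_of_constantCoeff_zero
    intro s
    change PowerSeries.constantCoeff _ = 0
    simp
  refine ⟨MvPowerSeries.substAlgHom ha, fun i => MvPowerSeries.substAlgHom_X ha i, ?_⟩
  intro P d
  rw [MvPowerSeries.substAlgHom_apply, PowerSeries.coeff, MvPowerSeries.coeff_subst ha]
  apply finsum_induction (fun p : MvPolynomial (Fin 2) ℂ => p.IsHomogeneous d)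
  · exact MvPolynomial.isHomogeneous_zero _ _ _
  · intro x y hx hy; exact hx.add hy
  · intro e
    rw [MvPolynomial.smul_eq_C_mul]
    have : (e.prod fun s n => (PowerSeries.C (MvPolynomial.X s : MvPolynomial (Fin 2) ℂ) * PowerSeries.X :
      PowerSeries (MvPolynomial (Fin 2) ℂ)) ^ n) =
       PowerSeries.C (MvPolynomial.X 0 ^ e 0 * MvPolynomial.X 1 ^ e 1) * PowerSeries.X ^ (e 0 + e 1) := by
      rw [Finsupp.prod_fintype _ _ (by simp)]
      simp [Fin.prod_univ_two]
      ring
    have h2 := this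
    erw [h2]
    change MvPolynomial.IsHomogeneous (MvPolynomial.C _ * PowerSeries.coeff d _) d
    rw [PowerSeries.coeff_C_mul, PowerSeries.coeff_X_pow]
    split_ifs with h
    · subst h
      rw [mul_one]
      have := (((MvPolynomial.isHomogeneous_X ℂ (0 : Fin 2)).pow (e 0)).mul
        ((MvPolynomial.isHomogeneous_X ℂ (1 : Fin 2)).pow (e 1))).C_mul (MvPowerSeries.coeff e P)
      simpa using this
    · simpa using MvPolynomial.isHomogeneous_zero _ _ _

lemma decomp (g : MvPowerSeries (Fin 2) ℂ) (hg : MvPowerSeries.constantCoeff g = 0) :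
    ∃ a b, g = MvPowerSeries.X 0 * a + MvPowerSeries.X 1 * b := by
  classical
  let b : MvPowerSeries (Fin 2) ℂ := fun m => if m 0 = 0 then MvPowerSeries.coeff m g else 0
  have h : MvPowerSeries.X 0 ∣ (g - b) := by
    rw [MvPowerSeries.X_dvd_iff]
    intro m hm
    rw [map_sub, sub_eq_zero]
    change _ = if m 0 = 0 then MvPowerSeries.coeff m g else 0
    simp [hm]
  have h' : MvPowerSeries.X 1 ∣ b := by
    rw [MvPowerSeries.X_dvd_iff]
    intro m hm
    change (if m 0 = 0 then MvPowerSeries.coeff m g else 0) = 0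
    split_ifs with h
    · have : m = 0 := by ext i; fin_cases i <;> simp [h, hm]
      rw [this]; simpa using hg
    · rfl
  obtain ⟨a, ha⟩ := h
  obtain ⟨b', hb⟩ := h'
  exact ⟨a, b', by rw [← ha, ← hb]; ring⟩

lemma core {R : Type*} [CommRing R] [IsDomain R] (y p2 p3 p4 p5 p6 p7 : R) (hy : Prime y)
    (h2 : (2 : R) ∣ 1) 
    (e5 : y * p4 + p2 * p3 = 0)
    (e6 : p3 ^ 2 + 2 * (y * p5) + 2 * (p2 * p4) = 0)
    (e7 : y * p6 + p2 * p5 + p3 * p4 = 0)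
    (e8 : p4 ^ 2 + 2 * (y * p7) + 2 * (p2 * p6) + 2 * (p3 * p5) = 0) :
    (∃ c, p3 = y ^ 4 * c) ∨ (y ∣ p2 ∧ y ∣ p3) := by
  have h20 : (2 : R) ≠ 0 := by
    rintro h; rw [h] at h2; exact one_ne_zero (zero_dvd_iff.mp h2)
  have hy2 : ¬ y ∣ 2 := fun h => hy.not_isUnit (isUnit_of_dvd_one (h.trans h2))
  have hy0 := hy.ne_zero
  by_cases hp : y ∣ p2
  · right
    refine ⟨hp, ?_⟩
    obtain ⟨r, rfl⟩ := hp
    have : y ∣ p3 ^ 2 := ⟨-(2 * p5 + 2 * r * p4), by linear_combination e6⟩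
    exact hy.dvd_of_dvd_pow this
  · left
    have key : ∀ x n, y ∣ p2 ^ n * x → y ∣ x := fun x n h =>
      (hy.dvd_or_dvd h).resolve_left (fun h => hp (hy.dvd_of_dvd_pow h))
    have key2 : ∀ x n, y ∣ 2 * (p2 ^ n * x) → y ∣ x := fun x n h =>
      key x n ((hy.dvd_or_dvd h).resolve_left hy2)
    obtain ⟨r2, rfl⟩ := key p3 1 ⟨-p4, by linear_combination e5⟩
    have h4 : p4 = - p2 * r2 := mul_left_cancel₀ hy0 (by linear_combination e5)
    subst h4
    obtain ⟨r1, rfl⟩ := key2 r2 2 ⟨y * r2 ^ 2 + 2 * p5, by linear_combination -e6⟩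
    have h5 : 2 * p5 = 2 * (p2 ^ 2 * r1) - y ^ 3 * r1 ^ 2 :=
      mul_left_cancel₀ hy0 (by linear_combination e6)
    obtain ⟨c, rfl⟩ := key2 r1 3 ⟨-2 * p6 + 3 * y ^ 2 * p2 * r1 ^ 2, by linear_combination 2 * e7 - p2 * h5⟩
    have h6 : 2 * p6 = 3 * y ^ 4 * p2 * c ^ 2 - 2 * p2 ^ 3 * c :=
      mul_left_cancel₀ hy0 (by linear_combination 2 * e7 - p2 * h5)
    obtain ⟨c', rfl⟩ : y ∣ c := by
      apply key2 c 4
      refine ⟨y ^ 3 * c ^ 2 * p2 ^ 2 + 2 * p7 + 3 * y ^ 3 * p2 ^ 2 * c ^ 2 + 2 * y ^ 2 * c * p5, ?_⟩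
      linear_combination e8 * (-1) + p2 * h6
    exact ⟨c', by ring⟩

lemma theta_hom (Θ : MvPowerSeries (Fin 2) ℂ →ₐ[ℂ] PowerSeries (MvPolynomial (Fin 2) ℂ))
    (hX : ∀ i, Θ (MvPowerSeries.X i) = PowerSeries.C (MvPolynomial.X i) * PowerSeries.X)
    (f : MvPolynomial (Fin 2) ℂ) (d : ℕ) (hf : f.IsHomogeneous d) :
    Θ (f : MvPowerSeries (Fin 2) ℂ) = PowerSeries.C f * PowerSeries.X ^ d := by
  have h1 : Θ (f : MvPowerSeries (Fin 2) ℂ) =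
      MvPolynomial.aeval (fun i => PowerSeries.C (MvPolynomial.X i) * PowerSeries.X) f := by
    have : Θ.comp (MvPolynomial.coeToMvPowerSeries.algHom ℂ) =
      MvPolynomial.aeval (fun i => PowerSeries.C (MvPolynomial.X i) * PowerSeries.X) := by
      apply MvPolynomial.algHom_ext
      intro i
      simp [hX]
    rw [← this]
    simp
  rw [h1]
  conv_lhs => rw [f.as_sum]
  conv_rhs => rw [f.as_sum]
  rw [map_sum, map_sum, Finset.sum_mul]
  apply Finset.sum_congr rfl
  intro m hm
  have hd : m 0 + m 1 = d := by
    have := hf (MvPolynomial.mem_support_iff.mp hm)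
    rw [Finsupp.weight_apply, Finsupp.sum_fintype _ _ (by simp)] at this
    simpa [Fin.sum_univ_two] using this
  rw [MvPolynomial.aeval_monomial, MvPolynomial.monomial_eq,
    Finsupp.prod_fintype _ _ (by simp), Finsupp.prod_fintype _ _ (by simp), ← hd]
  simp only [Fin.prod_univ_two, map_mul, map_pow]
  have : algebraMap ℂ (PowerSeries (MvPolynomial (Fin 2) ℂ)) (MvPolynomial.coeff m f) =
    PowerSeries.C (MvPolynomial.C (MvPolynomial.coeff m f)) := by
    rw [PowerSeries.algebraMap_apply]; rfl
  rw [this]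
  ring

lemma prime_lin (y : MvPolynomial (Fin 2) ℂ) (hy : y.IsHomogeneous 1) (h0 : y ≠ 0) : Prime y := by
  rw [← irreducible_iff_prime]
  apply MvPolynomial.irreducible_of_totalDegree_eq_one (hy.totalDegree h0)
  intro x hx
  rw [isUnit_iff_ne_zero]
  rintro rfl
  apply h0
  ext i
  simpa using hx i

lemma sqrt_trunc {R : Type*} [CommRing R] (e : R) : ∃ S W : R, S ^ 2 = 1 + 4 * e + e ^ 9 * W :=
  ⟨1 + 2*e - 2*e^2 + 4*e^3 - 10*e^4 + 28*e^5 - 84*e^6 + 264*e^7 - 858*e^8,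
   (-5720)*e^0 + (8008)*e^1 + (-16848)*e^2 + (39000)*e^3 + (-92400)*e^4 + (213840)*e^5 + (-453024)*e^6 + (736164)*e^7, by ring⟩

lemma hom_big (y p c : MvPolynomial (Fin 2) ℂ) (hy : y.IsHomogeneous 1) (h0 : y ≠ 0)
    (hp : p.IsHomogeneous 3) (h : p = y ^ 4 * c) : p = 0 := by
  by_contra hne
  have hc : c ≠ 0 := by rintro rfl; simp at h; exact hne h
  have h1 := hp.totalDegree hne
  have h2 := (hy.pow 4).totalDegree (pow_ne_zero 4 h0)
  rw [h, MvPolynomial.totalDegree_mul_of_isDomain (pow_ne_zero 4 h0) hc, h2] at h1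
  omega

lemma linform {n : ℕ} (p : MvPolynomial (Fin n) ℂ) (hp : p.IsHomogeneous 1) :
    ∃ c : Fin n → ℂ, p = ∑ i, MvPolynomial.C (c i) * MvPolynomial.X i := by
  have : p ∈ MvPolynomial.homogeneousSubmodule (Fin n) ℂ 1 := hp
  rw [MvPolynomial.homogeneousSubmodule_one_eq_span_X, Submodule.mem_span_range_iff_exists_fun] at this
  obtain ⟨c, hc⟩ := this
  exact ⟨c, by rw [← hc]; simp [MvPolynomial.smul_eq_C_mul]⟩

lemma two_dvd_one : (2 : MvPolynomial (Fin 2) ℂ) ∣ 1 :=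
  ⟨MvPolynomial.C (1/2), by
    rw [show (2 : MvPolynomial (Fin 2) ℂ) = MvPolynomial.C 2 from rfl, ← map_mul]; norm_num⟩

lemma germ0 (F : MvPolynomial (Fin 2) ℂ) (k : ℕ) (hF : IsAk F k) :
    ∃ u A B : MvPowerSeries (Fin 2) ℂ, (F : MvPowerSeries (Fin 2) ℂ) = u * (A ^ 2 + B ^ (k + 1)) ∧
      MvPowerSeries.constantCoeff u ≠ 0 ∧ MvPowerSeries.constantCoeff A = 0 ∧
      MvPowerSeries.constantCoeff B = 0 ∧ ∀ i, ∃ g h, MvPowerSeries.X i = A * g + B * h := by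
  obtain ⟨φ, hφ⟩ := hF
  have : IsDomain (MvPowerSeries (Fin 2) ℂ) := NoZeroDivisors.to_isDomain _
  rw [Ideal.map_span, Set.image_singleton, Ideal.span_singleton_eq_span_singleton] at hφ
  obtain ⟨U, hU⟩ := hφ.symm
  have hcc : ∀ (ψ : MvPowerSeries (Fin 2) ℂ ≃ₐ[ℂ] MvPowerSeries (Fin 2) ℂ) i,
      MvPowerSeries.constantCoeff (ψ (MvPowerSeries.X i)) = 0 := by
    intro ψ i
    by_contra h
    have h1 : IsUnit (ψ (MvPowerSeries.X i)) :=
      MvPowerSeries.isUnit_iff_constantCoeff.mpr (isUnit_iff_ne_zero.mpr h)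
    have h2 : IsUnit (MvPowerSeries.X i : MvPowerSeries (Fin 2) ℂ) := by
      simpa using h1.map ψ.symm
    have h3 := MvPowerSeries.isUnit_iff_constantCoeff.mp h2
    simp at h3
  refine ⟨φ.symm U, φ.symm (MvPowerSeries.X 0), φ.symm (MvPowerSeries.X 1), ?_, ?_, hcc _ _, hcc _ _, ?_⟩
  · apply φ.injective
    simp only [map_mul, map_add, map_pow, AlgEquiv.apply_symm_apply]
    rw [mul_comm, hU]; rfl
  · have := (U.isUnit.map φ.symm)
    rw [MvPowerSeries.isUnit_iff_constantCoeff] at this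
    exact this.ne_zero
  · intro i
    obtain ⟨a, b, hab⟩ := decomp _ (hcc φ i)
    refine ⟨φ.symm a, φ.symm b, ?_⟩
    rw [← map_mul, ← map_mul, ← map_add, ← hab, AlgEquiv.symm_apply_apply]

lemma germ (F : MvPolynomial (Fin 2) ℂ) (k : ℕ) (hk : 1 ≤ k) (hF : IsAk F k)
    (f : ℕ → MvPolynomial (Fin 2) ℂ) (hf : ∀ d, (f d).IsHomogeneous d)
    (hsum : F = ∑ d ∈ Finset.range 5, f d) :
    (f 0 = 0 ∧ f 1 = 0) ∧
    (3 ≤ k → ∀ w, MvPolynomial.eval w (f 2) = 0 → MvPolynomial.eval w (f 3) = 0) ∧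
    (k = 2 → ∀ w, MvPolynomial.eval w (f 2) = 0 → MvPolynomial.eval w (f 3) = 0 → w = 0) ∧
    (8 ≤ k → ∃ y p2, y.IsHomogeneous 1 ∧ p2.IsHomogeneous 2 ∧
      ((f 2 = y ^ 2 ∧ f 3 = 2 * y * p2 ∧ f 4 = p2 ^ 2) ∨
       (y ^ 2 ∣ f 2 ∧ y ^ 2 ∣ f 3 ∧ y ^ 2 ∣ f 4))) := by
  obtain ⟨u, A, B, hfu, hu, hA, hB, hgen⟩ := germ0 F k hF
  obtain ⟨Θ, hX, hhom⟩ := exTheta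
  have hc : ∀ d, PowerSeries.coeff d (Θ (F : MvPowerSeries (Fin 2) ℂ)) = if d < 5 then f d else 0 := by
    intro d
    have : (F : MvPowerSeries (Fin 2) ℂ) = ∑ d ∈ Finset.range 5, (f d : MvPowerSeries (Fin 2) ℂ) := by
      rw [hsum]
      simp only [← MvPolynomial.coeToMvPowerSeries.ringHom_apply]
      exact map_sum _ _ _
    rw [this, map_sum, map_sum]
    simp_rw [fun d => theta_hom Θ hX (f d) d (hf d), PowerSeries.coeff_C_mul, PowerSeries.coeff_X_pow]
    simp
  have hdiv : ∀ g, MvPowerSeries.constantCoeff g = 0 → ∃ g', Θ g = PowerSeries.X * g' := by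
    intro g hg
    obtain ⟨a, b, rfl⟩ := decomp g hg
    refine ⟨PowerSeries.C (MvPolynomial.X 0) * Θ a + PowerSeries.C (MvPolynomial.X 1) * Θ b, ?_⟩
    simp only [map_add, map_mul, hX]; ring
  have hd0 : ∀ g, MvPowerSeries.constantCoeff g = 0 → PowerSeries.coeff 0 (Θ g) = 0 := by
    intro g hg
    obtain ⟨g', h⟩ := hdiv g hg
    simp [h]
  obtain ⟨A', hA'⟩ := hdiv A hA
  obtain ⟨B', hB'⟩ := hdiv B hB
  have hu0 : ∃ c : ℂ, c ≠ 0 ∧ PowerSeries.coeff 0 (Θ u) = MvPolynomial.C c := by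
    have h1 : IsUnit (PowerSeries.coeff 0 (Θ u)) := by
      have : IsUnit u := MvPowerSeries.isUnit_iff_constantCoeff.mpr (isUnit_iff_ne_zero.mpr hu)
      simpa using (this.map Θ).map PowerSeries.constantCoeff
    obtain ⟨r, hr, h⟩ := MvPolynomial.isUnit_iff_eq_C_of_isReduced.mp h1
    exact ⟨r, hr.ne_zero, h⟩
  obtain ⟨c0, hc0, hcu⟩ := hu0
  -- linear parts are independent
  set a1 := PowerSeries.coeff 0 A' with ha1
  set b1 := PowerSeries.coeff 0 B' with hb1
  have ha1' : PowerSeries.constantCoeff A' = a1 := by simp [a1]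
  have hb1' : PowerSeries.constantCoeff B' = b1 := by simp [b1]
  have hA1 : PowerSeries.coeff 1 (Θ A) = a1 := by
    rw [hA', show 1 = 0 + 1 from rfl, PowerSeries.coeff_succ_X_mul]
  have hB1 : PowerSeries.coeff 1 (Θ B) = b1 := by
    rw [hB', show 1 = 0 + 1 from rfl, PowerSeries.coeff_succ_X_mul]
  have hind : ∀ w, MvPolynomial.eval w a1 = 0 → MvPolynomial.eval w b1 = 0 → w = 0 := by
    intro w h1 h2
    ext i
    obtain ⟨g, h, hgh⟩ := hgen i
    have := congrArg (fun z => MvPolynomial.eval w (PowerSeries.coeff (0 + 1) (Θ z))) hgh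
    simp only [map_add, map_mul, hX, hA', hB', mul_assoc, PowerSeries.coeff_succ_X_mul] at this
    rw [PowerSeries.coeff_succ_mul_X] at this
    simpa [ha1', hb1', h1, h2] using this
  have hFA : Θ (F : MvPowerSeries (Fin 2) ℂ) =
      PowerSeries.X ^ 2 * (Θ u * A' ^ 2) + PowerSeries.X ^ (k + 1) * (Θ u * B' ^ (k + 1)) := by
    rw [hfu]; simp only [map_add, map_mul, map_pow, hA', hB']; ring
  have hlow : ∀ d, d < k + 1 → PowerSeries.coeff d (Θ (F : MvPowerSeries (Fin 2) ℂ)) =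
      PowerSeries.coeff d (PowerSeries.X ^ 2 * (Θ u * A' ^ 2)) := by
    intro d hd
    rw [hFA, map_add, PowerSeries.coeff_X_pow_mul', PowerSeries.coeff_X_pow_mul' _ (k + 1),
      if_neg (not_le.mpr hd), add_zero]
  refine ⟨⟨?_, ?_⟩, ?_, ?_, ?_⟩
  · have := hlow 0 (by omega)
    rw [hc, PowerSeries.coeff_X_pow_mul'] at this
    simpa using this
  · have := hlow 1 (by omega)
    rw [hc, PowerSeries.coeff_X_pow_mul'] at this
    simpa using this
  · intro hk3 w hw
    have h2 := hlow 2 (by omega)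
    have h3 := hlow 3 (by omega)
    rw [hc, PowerSeries.coeff_X_pow_mul'] at h2 h3
    simp [PowerSeries.coeff_mul, pow_two, Finset.Nat.antidiagonal_succ] at h2 h3
    simp only [← PowerSeries.coeff_zero_eq_constantCoeff_apply, hcu, ← ha1] at h2 h3
    rw [h2] at hw
    have : MvPolynomial.eval w a1 = 0 := by
      simpa [hc0] using hw
    rw [h3]
    simp [this]
  · intro hk2 w hw2 hw3
    subst hk2
    have h2 := hlow 2 (by omega)
    have h3 := congrArg (PowerSeries.coeff 3) hFA
    rw [hc, PowerSeries.coeff_X_pow_mul'] at h2 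
    rw [hc, map_add, PowerSeries.coeff_X_pow_mul', PowerSeries.coeff_X_pow_mul'] at h3
    simp [PowerSeries.coeff_mul, pow_two, Finset.Nat.antidiagonal_succ] at h2 h3
    simp only [← PowerSeries.coeff_zero_eq_constantCoeff_apply, hcu, ← ha1, ← hb1] at h2 h3
    rw [h2] at hw2
    have : MvPolynomial.eval w a1 = 0 := by
      simpa [hc0] using hw2
    rw [h3] at hw3
    simp [this, hc0] at hw3
    exact hind w this hw3
  · intro hk8
    obtain ⟨c, hcc⟩ := IsAlgClosed.exists_pow_nat_eq (MvPowerSeries.constantCoeff u) (n := 2) (by norm_num)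
    have hcne : c ≠ 0 := by rintro rfl; simp at hcc; exact hu hcc.symm
    obtain ⟨e, he⟩ : ∃ e, e = MvPowerSeries.C (1/4 : ℂ) *
      (MvPowerSeries.C (MvPowerSeries.constantCoeff u)⁻¹ * u - 1) := ⟨_, rfl⟩
    have he0 : MvPowerSeries.constantCoeff e = 0 := by
      rw [he]; simp [hu]
    have hue : u = MvPowerSeries.C c ^ 2 * (1 + 4 * e) := by
      have h4 : (4 : MvPowerSeries (Fin 2) ℂ) * MvPowerSeries.C (1/4 : ℂ) = 1 := by
        rw [show (4 : MvPowerSeries (Fin 2) ℂ) = MvPowerSeries.C 4 from (map_ofNat _ 4).symm, ← map_mul]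
        norm_num
      have h5 : MvPowerSeries.C c ^ 2 * MvPowerSeries.C (MvPowerSeries.constantCoeff u)⁻¹ =
          (1 : MvPowerSeries (Fin 2) ℂ) := by
        rw [← map_pow, hcc, ← map_mul, mul_inv_cancel₀ hu, map_one]
      rw [he]
      linear_combination (-u) * h5 - MvPowerSeries.C c ^ 2 * (MvPowerSeries.C (MvPowerSeries.constantCoeff u)⁻¹ * u - 1) * h4
    obtain ⟨S, W, hS⟩ := sqrt_trunc e
    obtain ⟨P, hP⟩ : ∃ P, P = MvPowerSeries.C c * S * A := ⟨_, rfl⟩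
    have hFP : (F : MvPowerSeries (Fin 2) ℂ) = P ^ 2 - e ^ 9 * (W * MvPowerSeries.C c ^ 2 * A ^ 2)
        + B ^ 9 * (u * B ^ (k - 8)) := by
      have : B ^ (k + 1) = B ^ 9 * B ^ (k - 8) := by rw [← pow_add]; congr 1; omega
      rw [hfu, this, hP]
      linear_combination A ^ 2 * hue - MvPowerSeries.C c ^ 2 * A ^ 2 * hS
    obtain ⟨e', he'⟩ := hdiv e he0
    have hP0 : MvPowerSeries.constantCoeff P = 0 := by rw [hP]; simp [hA]
    have hp0 := hd0 P hP0
    have hlow2 : ∀ d, d < 9 → PowerSeries.coeff d (Θ P ^ 2) = if d < 5 then f d else 0 := by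
      intro d hd
      rw [← hc, hFP]
      simp only [map_add, map_sub, map_mul, map_pow, he', hB', mul_pow, mul_assoc]
      rw [PowerSeries.coeff_X_pow_mul', PowerSeries.coeff_X_pow_mul', if_neg (not_le.mpr hd),
        if_neg (not_le.mpr hd)]
      simp
    obtain ⟨p, hp⟩ : ∃ p : ℕ → MvPolynomial (Fin 2) ℂ, ∀ d, PowerSeries.coeff d (Θ P) = p d :=
      ⟨_, fun _ => rfl⟩
    rw [hp] at hp0
    have hph : ∀ d, (p d).IsHomogeneous d := fun d => hp d ▸ hhom P d
    have E2 := hlow2 2 (by norm_num)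
    have E3 := hlow2 3 (by norm_num)
    have E4 := hlow2 4 (by norm_num)
    have E5 := hlow2 5 (by norm_num)
    have E6 := hlow2 6 (by norm_num)
    have E7 := hlow2 7 (by norm_num)
    have E8 := hlow2 8 (by norm_num)
    simp only [pow_two, PowerSeries.coeff_mul, Finset.Nat.sum_antidiagonal_eq_sum_range_succ_mk,
      Finset.sum_range_succ, Finset.sum_range_zero, hp] at E2 E3 E4 E5 E6 E7 E8
    norm_num [hp0] at E2 E3 E4 E5 E6 E7 E8
    have h20 : (2 : MvPolynomial (Fin 2) ℂ) ≠ 0 := two_ne_zero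
    have hne : p 1 ≠ 0 := by
      intro h
      have h1 := hlow 2 (by omega)
      rw [hc, PowerSeries.coeff_X_pow_mul'] at h1
      simp [PowerSeries.coeff_mul, pow_two, Finset.Nat.antidiagonal_succ] at h1
      simp only [← PowerSeries.coeff_zero_eq_constantCoeff_apply, hcu, ← ha1] at h1
      rw [← E2, h] at h1
      have ha0 : a1 = 0 := by
        simpa [hc0] using h1.symm
      have hbh : b1.IsHomogeneous 1 := hB1 ▸ hhom B 1
      have hlin : ∃ α β, ∀ x y : ℂ, MvPolynomial.eval ![x, y] b1 = α * x + β * y := by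
        obtain ⟨c, hcb⟩ := linform b1 hbh
        exact ⟨c 0, c 1, fun x y => by rw [hcb]; simp [Fin.sum_univ_two]⟩
      obtain ⟨α, β, hl⟩ := hlin
      have h2 := hind ![β, -α] (by simp [ha0]) (by rw [hl]; ring)
      have h3 := congrFun h2 0
      have h4 := congrFun h2 1
      simp at h3 h4
      have h5 := congrFun (hind ![1, 0] (by simp [ha0]) (by rw [hl]; simp [h3, h4])) 0
      simp at h5
    have hprime := prime_lin (p 1) (hph 1) hne
    refine ⟨p 1, p 2, hph 1, hph 2, ?_⟩
    rcases core (p 1) (p 2) (p 3) (p 4) (p 5) (p 6) (p 7) hprime two_dvd_one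
      (mul_left_cancel₀ h20 (by linear_combination E5)) (by linear_combination E6)
      (mul_left_cancel₀ h20 (by linear_combination E7)) (by linear_combination E8) with ⟨c, h⟩ | ⟨h1, h2⟩
    · left
      have := hom_big _ _ _ (hph 1) hne (hph 3) h
      rw [this] at E4
      refine ⟨by rw [← E2]; ring, by rw [← E3]; ring, by rw [← E4]; ring⟩
    · right
      obtain ⟨r, hr⟩ := h1
      obtain ⟨s, hs⟩ := h2
      rw [← E2, ← E3, ← E4, hr, hs]
      exact ⟨⟨1, by ring⟩, ⟨2 * r, by ring⟩, ⟨r ^ 2 + 2 * s, by ring⟩⟩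

lemma hom_smul {S : Type*} [CommRing S] [Algebra ℂ S] (f : MvPolynomial (Fin 2) ℂ) (d : ℕ)
    (hf : f.IsHomogeneous d) (s : S) (g : Fin 2 → S) :
    MvPolynomial.aeval (fun i => s * g i) f = s ^ d * MvPolynomial.aeval g f := by
  conv_lhs => rw [f.as_sum]
  conv_rhs => rw [f.as_sum]
  rw [map_sum, map_sum, Finset.mul_sum]
  apply Finset.sum_congr rfl
  intro m hm
  have hd : m 0 + m 1 = d := by
    have := hf (MvPolynomial.mem_support_iff.mp hm)
    rw [Finsupp.weight_apply, Finsupp.sum_fintype _ _ (by simp)] at this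
    simpa [Fin.sum_univ_two] using this
  rw [MvPolynomial.aeval_monomial, MvPolynomial.aeval_monomial,
    Finsupp.prod_fintype _ _ (by simp), Finsupp.prod_fintype _ _ (by simp), ← hd]
  simp only [Fin.prod_univ_two]
  ring

lemma expand (G : MvPolynomial (Fin 3) ℂ) (hG : G.IsHomogeneous 4) :
    ∃ f : ℕ → MvPolynomial (Fin 2) ℂ, (∀ d, (f d).IsHomogeneous d) ∧
      G = ∑ d ∈ Finset.range 5, MvPolynomial.X 2 ^ (4 - d) *
        MvPolynomial.aeval ![MvPolynomial.X 0, MvPolynomial.X 1] (f d) := by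
  rw [G.as_sum]
  apply Finset.sum_induction _ (fun G => ∃ f : ℕ → MvPolynomial (Fin 2) ℂ, (∀ d, (f d).IsHomogeneous d) ∧
      G = ∑ d ∈ Finset.range 5, MvPolynomial.X 2 ^ (4 - d) *
        MvPolynomial.aeval ![MvPolynomial.X 0, MvPolynomial.X 1] (f d))
  · rintro a b ⟨f, hf, rfl⟩ ⟨g, hg, rfl⟩
    exact ⟨f + g, fun d => (hf d).add (hg d), by simp [← Finset.sum_add_distrib, mul_add]⟩
  · exact ⟨0, fun d => MvPolynomial.isHomogeneous_zero _ _ _, by simp⟩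
  · intro m hm
    have hd : m 0 + m 1 + m 2 = 4 := by
      have := hG (MvPolynomial.mem_support_iff.mp hm)
      rw [Finsupp.weight_apply, Finsupp.sum_fintype _ _ (by simp)] at this
      simpa [Fin.sum_univ_three] using this
    refine ⟨fun d => if d = m 0 + m 1 then MvPolynomial.C (MvPolynomial.coeff m G) *
      (MvPolynomial.X 0 ^ m 0 * MvPolynomial.X 1 ^ m 1) else 0, ?_, ?_⟩
    · intro d
      dsimp only
      split_ifs with h
      · subst h
        have := (((MvPolynomial.isHomogeneous_X ℂ (0 : Fin 2)).pow (m 0)).mul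
          ((MvPolynomial.isHomogeneous_X ℂ (1 : Fin 2)).pow (m 1))).C_mul (MvPolynomial.coeff m G)
        simpa using this
      · exact MvPolynomial.isHomogeneous_zero _ _ _
    · rw [Finset.sum_eq_single (m 0 + m 1)]
      · rw [MvPolynomial.monomial_eq, Finsupp.prod_fintype _ _ (by simp),
          show 4 - (m 0 + m 1) = m 2 by omega]
        simp [Fin.prod_univ_three, MvPolynomial.algebraMap_eq]
        ring
      · intro b _ hb
        simp [hb]
      · intro h
        exact absurd (Finset.mem_range.mpr (by omega)) h

lemma dvd_of_zero (T l : MvPolynomial (Fin 3) ℂ) (hl0 : l ≠ 0) (hl : l.IsHomogeneous 1)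
    (h : ∀ x, MvPolynomial.eval x l = 0 → MvPolynomial.eval x T = 0) : l ∣ T := by
  obtain ⟨c, hc⟩ := linform l hl
  obtain ⟨i, hi⟩ : ∃ i, c i ≠ 0 := by
    by_contra! hh
    apply hl0
    rw [hc]; simp [hh]
  have hlx : ∀ x, MvPolynomial.eval x l = ∑ j, c j * x j := by
    intro x; rw [hc]; simp
  let g : Fin 3 → MvPolynomial (Fin 3) ℂ := fun j => MvPolynomial.X j - MvPolynomial.C (if j = i then (c i)⁻¹ else 0) * l
  have h0 : MvPolynomial.aeval g T = 0 := by
    apply MvPolynomial.funext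
    intro x
    have : MvPolynomial.eval x (MvPolynomial.aeval g T) =
      MvPolynomial.eval (fun j => MvPolynomial.eval x (g j)) T := by
      rw [← MvPolynomial.coe_aeval_eq_eval, ← MvPolynomial.coe_aeval_eq_eval, RingHom.coe_coe,
        RingHom.coe_coe, ← MvPolynomial.comp_aeval_apply]
    rw [this, map_zero]
    apply h
    rw [hlx]
    simp only [g, map_sub, map_mul, MvPolynomial.eval_X, MvPolynomial.eval_C, mul_sub, Finset.sum_sub_distrib]
    rw [← hlx]
    simp [hi]
  have h1 : (Ideal.Quotient.mkₐ ℂ (Ideal.span {l})).comp (MvPolynomial.aeval g) =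
      Ideal.Quotient.mkₐ ℂ (Ideal.span {l}) := by
    apply MvPolynomial.algHom_ext
    intro j
    rw [AlgHom.comp_apply, MvPolynomial.aeval_X]
    simp only [Ideal.Quotient.mkₐ_eq_mk]
    rw [Ideal.Quotient.eq, Ideal.mem_span_singleton]
    exact ⟨- MvPolynomial.C (if j = i then (c i)⁻¹ else 0), by simp only [g]; ring⟩
  have h2 := DFunLike.congr_fun h1 T
  rw [AlgHom.comp_apply, h0, map_zero] at h2
  rw [← Ideal.mem_span_singleton, ← Ideal.Quotient.eq_zero_iff_mem]
  exact h2.symm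

lemma ker_span (c q v : Fin 3 → ℂ) (hc : c ≠ 0) (hq : q ≠ 0) (hvq : ¬ ∃ a : ℂ, v = a • q)
    (h1 : ∑ j, c j * q j = 0) (h2 : ∑ j, c j * v j = 0) (x : Fin 3 → ℂ) (hx : ∑ j, c j * x j = 0) :
    ∃ a b : ℂ, x = a • q + b • v := by
  let φ : Module.Dual ℂ (Fin 3 → ℂ) := Fintype.linearCombination ℂ c
  have hφ : ∀ z, φ z = ∑ j, c j * z j := by
    intro z; simp [φ, Fintype.linearCombination_apply, mul_comm]
  have hφ0 : φ ≠ 0 := by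
    intro h
    apply hc
    ext i
    have := DFunLike.congr_fun h (Pi.single i 1)
    rw [hφ] at this
    simpa [Pi.single_apply] using this
  have hk := Module.Dual.finrank_ker_add_one_of_ne_zero hφ0
  have hli : LinearIndependent ℂ ![q, v] := by
    rw [LinearIndependent.pair_iff' hq]
    intro a ha
    exact hvq ⟨a, ha.symm⟩
  have hs := finrank_span_eq_card hli
  have hle : Submodule.span ℂ (Set.range ![q, v]) ≤ LinearMap.ker φ := by
    rw [Submodule.span_le]
    rintro _ ⟨i, rfl⟩
    fin_cases i
    · simp [hφ, h1]
    · simp [hφ, h2]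
  have heq := Submodule.eq_of_le_of_finrank_eq hle (by
    rw [hs]; simp at hk ⊢; omega)
  have : x ∈ Submodule.span ℂ (Set.range ![q, v]) := by
    rw [heq]; simp [hφ, hx]
  simp [Submodule.mem_span_pair] at this
  obtain ⟨a, b, h⟩ := this
  exact ⟨b, a, by rw [← h, add_comm]⟩

lemma rootMult (p : Polynomial ℂ) (m : ℕ) (hp : p.eval 0 ≠ 0) :
    Polynomial.rootMultiplicity 0 (Polynomial.X ^ m * p) = m := by
  have h0 : p ≠ 0 := by rintro rfl; simp at hp
  have h := Polynomial.rootMultiplicity_mul_X_sub_C_pow (a := (0:ℂ)) (n := m) h0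
  rw [map_zero, sub_zero] at h
  rw [mul_comm, h, Polynomial.rootMultiplicity_eq_zero hp, zero_add]

/-- Let `Q ⊂ ℙ²` be a reduced quartic curve with a singular point `q` of type
`A_k`, and let `ℓ` be a line through `q` not contained in `Q`. Then the local intersection
multiplicity `n = (Q·ℓ)_q` (computed as the vanishing order at `0` of `T` along the
parametrization `t ↦ q + t·v` of `ℓ`) satisfies `n ∈ {2, 3, 4}`, with `k ≤ 7`, `n = 3` only
for `k ≤ 2`, and `n = 4` only for `k ≠ 2`. -/
theorem stmt_10 (T : MvPolynomial (Fin 3) ℂ) (hdeg : T.IsHomogeneous 4)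
    (hred : Squarefree T)
    (k : ℕ) (hk : 1 ≤ k) (q : Fin 3 → ℂ) (hq : q ≠ 0) (hAk : projAk T q k)
    (l : MvPolynomial (Fin 3) ℂ) (hl0 : l ≠ 0) (hl : l.IsHomogeneous 1)
    (hlq : MvPolynomial.eval q l = 0) (hlT : ¬ l ∣ T)
    (v : Fin 3 → ℂ) (hv : MvPolynomial.eval v l = 0) (hvq : ¬ ∃ c : ℂ, v = c • q)
    (n : ℕ)
    (hn : n = Polynomial.rootMultiplicity 0
      ((MvPolynomial.aeval fun j => Polynomial.C (q j) + Polynomial.C (v j) * Polynomial.X)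
        T)) :
    k ≤ 7 ∧ n ∈ ({2, 3, 4} : Set ℕ) ∧ (n = 3 → k ≤ 2) ∧ (n = 4 → k ≠ 2) := by
  obtain ⟨M, hM, hMq, hF⟩ := hAk
  obtain ⟨G, hGdef⟩ : ∃ G, G = (MvPolynomial.aeval fun i => ∑ j, MvPolynomial.C (M i j) * MvPolynomial.X j) T :=
    ⟨_, rfl⟩
  rw [← hGdef] at hF
  have hGhom : G.IsHomogeneous 4 := by
    rw [hGdef]
    have := hdeg.aeval (n := 1) (fun i => ∑ j, MvPolynomial.C (M i j) * MvPolynomial.X j) (by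
      intro i
      apply MvPolynomial.IsHomogeneous.sum
      intro j _
      exact (MvPolynomial.isHomogeneous_X ℂ j).C_mul _)
    simpa using this
  obtain ⟨f, hf, hGf⟩ := expand G hGhom
  have hGS : ∀ y : Fin 3 → Polynomial ℂ, MvPolynomial.aeval y G =
      ∑ d ∈ Finset.range 5, y 2 ^ (4 - d) * MvPolynomial.aeval ![y 0, y 1] (f d) := by
    intro y
    rw [hGf, map_sum]
    apply Finset.sum_congr rfl
    intro d _
    rw [map_mul, map_pow, MvPolynomial.aeval_X, ← AlgHom.comp_apply, MvPolynomial.comp_aeval]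
    congr 3
    ext i
    fin_cases i <;> simp
  have hGe : ∀ y : Fin 3 → ℂ, MvPolynomial.eval y G =
      ∑ d ∈ Finset.range 5, y 2 ^ (4 - d) * MvPolynomial.aeval ![y 0, y 1] (f d) := by
    intro y
    rw [← MvPolynomial.coe_aeval_eq_eval, RingHom.coe_coe, hGf, map_sum]
    apply Finset.sum_congr rfl
    intro d _
    rw [map_mul, map_pow, MvPolynomial.aeval_X, ← AlgHom.comp_apply, MvPolynomial.comp_aeval]
    congr 3
    ext i
    fin_cases i <;> simp
  have hFs : (MvPolynomial.aeval ![MvPolynomial.X 0, MvPolynomial.X 1, 1] G : MvPolynomial (Fin 2) ℂ) =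
      ∑ d ∈ Finset.range 5, f d := by
    rw [hGf, map_sum]
    apply Finset.sum_congr rfl
    intro d _
    rw [map_mul, map_pow, MvPolynomial.aeval_X, ← AlgHom.comp_apply, MvPolynomial.comp_aeval]
    have : (fun i => (MvPolynomial.aeval ![MvPolynomial.X 0, MvPolynomial.X 1, 1])
      ((![MvPolynomial.X 0, MvPolynomial.X 1] : Fin 2 → MvPolynomial (Fin 3) ℂ) i)) =
      (MvPolynomial.X : Fin 2 → MvPolynomial (Fin 2) ℂ) := by
      ext1 i
      fin_cases i <;> simp
    rw [this]
    simp
  obtain ⟨⟨hf0, hf1⟩, hk3, hk2, hk8⟩ := germ _ k hk hF f hf hFs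
  obtain ⟨w, hw⟩ : ∃ w, w = M⁻¹.mulVec v := ⟨_, rfl⟩
  have hMw : M.mulVec w = v := by
    rw [hw, Matrix.mulVec_mulVec, Matrix.mul_nonsing_inv _ hM, Matrix.one_mulVec]
  have hMq' : M⁻¹.mulVec q = ![0, 0, 1] := by
    rw [← hMq, Matrix.mulVec_mulVec, Matrix.nonsing_inv_mul _ hM, Matrix.one_mulVec]
  have hqi : ∀ i, q i = M i 2 := by
    intro i; rw [← hMq]; simp [Matrix.mulVec, dotProduct, Fin.sum_univ_three]
  have hvi : ∀ i, v i = M i 0 * w 0 + M i 1 * w 1 + M i 2 * w 2 := by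
    intro i; rw [← hMw]; simp [Matrix.mulVec, dotProduct, Fin.sum_univ_three]
  have hwne : (![w 0, w 1] : Fin 2 → ℂ) ≠ 0 := by
    intro h
    have h0 : w 0 = 0 := congrFun h 0
    have h1 : w 1 = 0 := congrFun h 1
    apply hvq
    refine ⟨w 2, ?_⟩
    ext i
    simp [hvi, hqi, h0, h1, mul_comm]
  obtain ⟨a, ha⟩ : ∃ a : ℕ → ℂ, ∀ d, a d = MvPolynomial.eval ![w 0, w 1] (f d) := ⟨_, fun _ => rfl⟩
  have hL : (MvPolynomial.aeval fun j => Polynomial.C (q j) + Polynomial.C (v j) * Polynomial.X) T =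
      ∑ d ∈ Finset.range 5, (1 + Polynomial.C (w 2) * Polynomial.X) ^ (4 - d) *
        (Polynomial.X ^ d * Polynomial.C (a d)) := by
    have h1 : (MvPolynomial.aeval fun j => Polynomial.C (q j) + Polynomial.C (v j) * Polynomial.X) T =
      MvPolynomial.aeval (![Polynomial.X * Polynomial.C (w 0), Polynomial.X * Polynomial.C (w 1),
        1 + Polynomial.C (w 2) * Polynomial.X] : Fin 3 → Polynomial ℂ) G := by
      rw [hGdef, ← AlgHom.comp_apply, MvPolynomial.comp_aeval]
      congr 2
      ext1 i
      simp only [map_sum, map_mul, MvPolynomial.aeval_X, Fin.sum_univ_three, MvPolynomial.algHom_C,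
        hqi, hvi, Polynomial.algebraMap_eq, map_add]
      simp
      ring
    rw [h1, hGS]
    apply Finset.sum_congr rfl
    intro d _
    have h2 := hom_smul (f d) d (hf d) (Polynomial.X : Polynomial ℂ) ![Polynomial.C (w 0), Polynomial.C (w 1)]
    have h3 : (fun i => (Polynomial.X : Polynomial ℂ) * ![Polynomial.C (w 0), Polynomial.C (w 1)] i) =
      ![Polynomial.X * Polynomial.C (w 0), Polynomial.X * Polynomial.C (w 1)] := by
      ext1 i; fin_cases i <;> simp
    rw [h3] at h2
    have h4 : MvPolynomial.aeval (![Polynomial.C (w 0), Polynomial.C (w 1)] : Fin 2 → Polynomial ℂ) (f d) =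
        Polynomial.C (a d) := by
      rw [ha, ← MvPolynomial.coe_aeval_eq_eval, RingHom.coe_coe]
      have := MvPolynomial.comp_aeval_apply (f := (![w 0, w 1] : Fin 2 → ℂ)) (Polynomial.CAlgHom (R := ℂ) (A := ℂ)) (f d)
      rw [Polynomial.CAlgHom_apply] at this
      rw [this]
      congr 2
      ext1 i; fin_cases i <;> simp
    rw [h4] at h2
    rw [← h2]
    rfl
  have ha0 : a 0 = 0 := by rw [ha, hf0, map_zero]
  have ha1 : a 1 = 0 := by rw [ha, hf1, map_zero]
  rw [hL] at hn
  simp only [Finset.sum_range_succ, Finset.sum_range_zero, ha0, ha1] at hn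
  have hnz : ¬ (a 2 = 0 ∧ a 3 = 0 ∧ a 4 = 0) := by
    rintro ⟨h2, h3, h4⟩
    apply hlT
    apply dvd_of_zero T l hl0 hl
    intro x hx
    obtain ⟨c, hc⟩ := linform l hl
    have hlx : ∀ x, MvPolynomial.eval x l = ∑ j, c j * x j := by
      intro x; rw [hc]; simp
    rw [hlx] at hlq hv hx
    have hcne : c ≠ 0 := by
      rintro rfl; apply hl0; rw [hc]; simp
    obtain ⟨α, β, hxx⟩ := ker_span c q v hcne hq hvq hlq hv x hx
    have h1 : MvPolynomial.eval x T = MvPolynomial.eval ![β * w 0, β * w 1, α + β * w 2] G := by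
      rw [hGdef, ← MvPolynomial.coe_aeval_eq_eval, ← MvPolynomial.coe_aeval_eq_eval, RingHom.coe_coe,
        RingHom.coe_coe, ← AlgHom.comp_apply, MvPolynomial.comp_aeval]
      congr 2
      ext1 i
      simp only [map_sum, map_mul, MvPolynomial.aeval_X, Fin.sum_univ_three, MvPolynomial.algHom_C]
      simp [hxx, hqi, hvi]
      ring
    rw [h1, hGe]
    apply Finset.sum_eq_zero
    intro d hd
    have h5 := hom_smul (f d) d (hf d) β ![w 0, w 1]
    have h6 : (fun i => β * (![w 0, w 1] : Fin 2 → ℂ) i) = ![β * w 0, β * w 1] := by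
      ext1 i; fin_cases i <;> simp
    rw [h6] at h5
    have h7 : MvPolynomial.aeval ![w 0, w 1] (f d) = a d := by
      rw [ha, ← MvPolynomial.coe_aeval_eq_eval, RingHom.coe_coe]
    have h8 : a d = 0 := by
      have := Finset.mem_range.mp hd
      interval_cases d <;> assumption
    rw [h7, h8, mul_zero] at h5
    simp [h5]
  have hsq : ∀ g : MvPolynomial (Fin 3) ℂ, g * g ∣ G → MvPolynomial.eval ![0, 0, 1] g = 0 → False := by
    intro g hg hg0
    let ψ : MvPolynomial (Fin 3) ℂ →ₐ[ℂ] MvPolynomial (Fin 3) ℂ :=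
      MvPolynomial.aeval fun i => ∑ j, MvPolynomial.C (M⁻¹ i j) * MvPolynomial.X j
    have hψ : ψ G = T := by
      rw [hGdef, ← AlgHom.comp_apply, MvPolynomial.comp_aeval]
      have : (fun i => ψ (∑ j, MvPolynomial.C (M i j) * MvPolynomial.X j)) = MvPolynomial.X := by
        ext1 i
        simp only [ψ, map_sum, map_mul, MvPolynomial.aeval_X, MvPolynomial.algHom_C,
          MvPolynomial.algebraMap_eq, Finset.mul_sum]
        rw [Finset.sum_comm]
        have h2 : ∀ j, ∑ k, M i k * M⁻¹ k j = if i = j then 1 else 0 := by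
          intro j
          rw [← Matrix.mul_apply, Matrix.mul_nonsing_inv _ hM, Matrix.one_apply]
        simp_rw [← mul_assoc, ← map_mul, ← Finset.sum_mul, ← map_sum, h2]
        simp
      rw [this]
      simp
    have h1 : ψ g * ψ g ∣ T := by
      rw [← hψ, ← map_mul]; exact map_dvd ψ hg
    have h2 := (hred _ h1).map (MvPolynomial.eval q)
    have h3 : MvPolynomial.eval q (ψ g) = MvPolynomial.eval ![0, 0, 1] g := by
      rw [← MvPolynomial.coe_aeval_eq_eval, ← MvPolynomial.coe_aeval_eq_eval, RingHom.coe_coe,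
        RingHom.coe_coe, ← AlgHom.comp_apply, MvPolynomial.comp_aeval]
      congr 2
      rw [← hMq']
      ext1 i
      simp [Matrix.mulVec, dotProduct]
    rw [h3, hg0] at h2
    simp at h2
  have hk7 : k ≤ 7 := by
    by_contra hk7
    obtain ⟨y, p2, hy, hp2, h⟩ := hk8 (by omega)
    have hι : ∀ (p : MvPolynomial (Fin 2) ℂ) d, p.IsHomogeneous (d + 1) →
        MvPolynomial.eval ![0, 0, 1] (MvPolynomial.aeval
          (![MvPolynomial.X 0, MvPolynomial.X 1] : Fin 2 → MvPolynomial (Fin 3) ℂ) p) = 0 := by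
      intro p d hp
      rw [← MvPolynomial.coe_aeval_eq_eval, RingHom.coe_coe, ← AlgHom.comp_apply, MvPolynomial.comp_aeval]
      have := hom_smul p _ hp (0 : ℂ) ![0, 0]
      rw [pow_succ, mul_zero, zero_mul] at this
      refine Eq.trans ?_ this
      congr 2
      ext1 i; fin_cases i <;> simp
    simp only [Finset.sum_range_succ, Finset.sum_range_zero, hf0, hf1] at hGf
    rcases h with ⟨h2, h3, h4⟩ | ⟨⟨r2, h2⟩, ⟨r3, h3⟩, ⟨r4, h4⟩⟩
    · apply hsq (MvPolynomial.X 2 * MvPolynomial.aeval ![MvPolynomial.X 0, MvPolynomial.X 1] y +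
        MvPolynomial.aeval ![MvPolynomial.X 0, MvPolynomial.X 1] p2)
      · rw [hGf, h2, h3, h4]
        simp only [map_mul, map_pow, map_zero, map_ofNat]
        exact ⟨1, by ring⟩
      · rw [map_add, map_mul, hι y 0 hy, hι p2 1 hp2]; simp
    · apply hsq (MvPolynomial.aeval ![MvPolynomial.X 0, MvPolynomial.X 1] y)
      · rw [hGf, h2, h3, h4]
        simp only [map_mul, map_pow, map_zero]
        rw [← pow_two]
        exact ⟨MvPolynomial.X 2 ^ 2 * MvPolynomial.aeval ![MvPolynomial.X 0, MvPolynomial.X 1] r2 +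
          MvPolynomial.X 2 * MvPolynomial.aeval ![MvPolynomial.X 0, MvPolynomial.X 1] r3 +
          MvPolynomial.aeval ![MvPolynomial.X 0, MvPolynomial.X 1] r4, by ring⟩
      · exact hι y 0 hy
  refine ⟨hk7, ?_⟩
  have hk3' := fun h => hk3 h ![w 0, w 1]
  have hk2' := fun h => hk2 h ![w 0, w 1]
  simp only [← ha] at hk3' hk2'
  by_cases h2 : a 2 = 0
  · by_cases h3 : a 3 = 0
    · have h4 : a 4 ≠ 0 := fun h4 => hnz ⟨h2, h3, h4⟩
      have : n = 4 := by
        rw [hn]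
        convert rootMult (Polynomial.C (a 4)) 4 (by simpa using h4) using 2
        simp [h2, h3]
      subst this
      refine ⟨by simp, by simp, fun _ hk => hwne (hk2' hk h2 h3)⟩
    · have : n = 3 := by
        rw [hn]
        convert rootMult ((1 + Polynomial.C (w 2) * Polynomial.X) * Polynomial.C (a 3) + Polynomial.X * Polynomial.C (a 4)) 3 (by simpa using h3) using 2
        simp [h2]; ring
      subst this
      refine ⟨by simp, fun _ => ?_, by simp⟩
      by_contra hk
      exact h3 (hk3' (by omega) h2)
  · have : n = 2 := by
      rw [hn]
      convert rootMult ((1 + Polynomial.C (w 2) * Polynomial.X) ^ 2 * Polynomial.C (a 2) + (1 + Polynomial.C (w 2) * Polynomial.X) * Polynomial.X * Polynomial.C (a 3) + Polynomial.X ^ 2 * Polynomial.C (a 4)) 2 (by simpa using h2) using 2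
      simp; ring
    subst this
    simp
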